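/- Let 0 < ν ≤ 1/2, μ ≥ ν and t > 0. Then for every a > 0 the function a ↦ R_{μ,ν}(a,t) is differentiable and ∂R_{μ,ν}/∂a (a,t) = −R_{μ−ν,ν}(a,t). -/

import Mathlib

open Real MeasureTheory

/-- The auxiliary function `R_{μ,ν}(a,t)` defined by its series representation. -/
noncomputable def R (μ ν a t : ℝ) : ℝ :=
  t ^ (μ - 1) * ∑' j : ℕ, (-(a * t ^ (-ν))) ^ j / (j.factorial * Real.Gamma (-ν * j + μ))

/-- A bound for the reciprocal Gamma function coming from the reflection formula. -/
lemma abs_inv_Gamma_le {x : ℝ} (hx : x < 1) : |(Real.Gamma x)⁻¹| ≤ Real.Gamma (1 - x) := by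
  have hpos : 0 < Real.Gamma (1 - x) := Real.Gamma_pos_of_pos (by linarith)
  rcases eq_or_ne (Real.Gamma x) 0 with h0 | h0
  · simpa [h0] using hpos.le
  have h := Real.Gamma_mul_Gamma_one_sub x
  have hs : Real.sin (π * x) ≠ 0 := by
    intro hs
    rw [hs, div_zero] at h
    exact mul_ne_zero h0 hpos.ne' h
  have hinv : (Real.Gamma x)⁻¹ = Real.Gamma (1 - x) * (Real.sin (π * x) / π) := by
    rw [eq_div_iff hs] at h
    rw [inv_eq_one_div, div_eq_iff h0, ← mul_div_assoc, div_mul_eq_mul_div,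
      eq_div_iff Real.pi_ne_zero]
    linarith
  rw [hinv, abs_mul, abs_of_pos hpos, abs_div, abs_of_pos Real.pi_pos]
  refine mul_le_of_le_one_right hpos.le ?_
  rw [div_le_one Real.pi_pos]
  linarith [Real.abs_sin_le_one (π * x), Real.pi_gt_three]

lemma sq_Gamma_one_add_half_le (j : ℕ) :
    Real.Gamma (1 + j / 2) ^ 2 ≤ j.factorial := by
  have hj : (0 : ℝ) < j + 1 := by positivity
  have h := Real.Gamma_mul_add_mul_le_rpow_Gamma_mul_rpow_Gamma (s := 1) (t := j + 1)
    (a := 1 / 2) (b := 1 / 2) one_pos hj (by norm_num) (by norm_num) (by norm_num)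
  rw [Real.Gamma_one, Real.one_rpow, one_mul, Real.Gamma_nat_eq_factorial,
    ← Real.sqrt_eq_rpow, show (1 / 2 * 1 + 1 / 2 * ((j : ℝ) + 1)) = 1 + j / 2 by ring] at h
  calc Real.Gamma (1 + j / 2) ^ 2 ≤ √(j.factorial : ℝ) ^ 2 :=
        pow_le_pow_left₀ (Real.Gamma_pos_of_pos (by positivity)).le h 2
    _ = j.factorial := Real.sq_sqrt (by positivity)

lemma pow_div_factorial_mul_Gamma_one_add_half_le (r : ℝ) (j : ℕ) :
    r ^ j / j.factorial * Real.Gamma (1 + j / 2) ≤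
      (1 / 2) ^ j + (2 * r ^ 2) ^ j / j.factorial := by
  have hf : (0 : ℝ) < j.factorial := by positivity
  set u := r ^ j / j.factorial * Real.Gamma (1 + j / 2) with hu
  have hu2 : u ^ 2 ≤ (r ^ 2) ^ j / j.factorial := by
    calc u ^ 2 = (r ^ j / j.factorial) ^ 2 * Real.Gamma (1 + j / 2) ^ 2 := mul_pow _ _ _
      _ ≤ (r ^ j / j.factorial) ^ 2 * j.factorial := by
        gcongr
        exact sq_Gamma_one_add_half_le j
      _ = (r ^ 2) ^ j / j.factorial := by
        rw [pow_right_comm]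
        field_simp
  have hp : (0 : ℝ) < 2 ^ j := by positivity
  have hq : (1 / 2 : ℝ) ^ j * 2 ^ j = 1 := by rw [← mul_pow]; norm_num
  have h3 : (2 * r ^ 2) ^ j / j.factorial = 2 ^ j * ((r ^ 2) ^ j / j.factorial) := by
    rw [mul_pow, mul_div_assoc]
  have h4 : u ≤ (1 / 2) ^ j + 2 ^ j * u ^ 2 := by
    have h5 : 0 < (1 / 2 : ℝ) ^ j := by positivity
    nlinarith [mul_nonneg h5.le (sq_nonneg (2 ^ j * u - 1)), mul_nonneg hp.le (sq_nonneg u),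
      show (1 / 2 : ℝ) ^ j * (2 ^ j * u - 1) ^ 2 = 2 ^ j * u ^ 2 - 2 * u + (1 / 2) ^ j by
        linear_combination (2 ^ j * u ^ 2 - 2 * u) * hq, sq_nonneg u]
  rw [h3]
  exact h4.trans (by gcongr)

lemma summable_pow_div_factorial_mul_abs_inv_Gamma {μ ν : ℝ} (hν : 0 < ν) (hν' : ν ≤ 1 / 2)
    (hμ : 0 ≤ μ) {r : ℝ} (hr : 0 ≤ r) :
    Summable fun j : ℕ => r ^ j / j.factorial * |(Real.Gamma (-ν * j + μ))⁻¹| := by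
  have hbound : Summable fun j : ℕ => (1 / 2 : ℝ) ^ j + (2 * r ^ 2) ^ j / j.factorial :=
    (summable_geometric_of_lt_one (by norm_num) (by norm_num)).add
      (Real.summable_pow_div_factorial _)
  refine hbound.of_norm_bounded_eventually_nat ?_
  obtain ⟨N, hN⟩ := exists_nat_ge ((μ + 1) / ν)
  filter_upwards [Filter.eventually_ge_atTop N] with j hj
  have hj' : μ + 1 ≤ ν * j := by
    have : (N : ℝ) ≤ j := by exact_mod_cast hj
    rw [div_le_iff₀ hν] at hN
    nlinarith
  have hjh : ν * j ≤ j / 2 := by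
    have : (0 : ℝ) ≤ j := by positivity
    nlinarith
  rw [Real.norm_of_nonneg (by positivity)]
  refine le_trans ?_ (pow_div_factorial_mul_Gamma_one_add_half_le r j)
  gcongr
  refine (abs_inv_Gamma_le (by linarith)).trans ?_
  exact Real.Gamma_strictMonoOn_Ici.monotoneOn (Set.mem_Ici.2 (by linarith))
    (Set.mem_Ici.2 (by linarith)) (by linarith)

/-- Termwise differentiation of an exponential generating function. -/
lemma hasDerivAt_tsum_pow_div_factorial_mul {c : ℕ → ℝ}
    (hc : ∀ r : ℝ, 0 ≤ r → Summable fun j : ℕ => r ^ j / j.factorial * |c (j + 1)|) (z : ℝ) :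
    HasDerivAt (fun z : ℝ => ∑' j : ℕ, z ^ j / j.factorial * c j)
      (∑' j : ℕ, z ^ j / j.factorial * c (j + 1)) z := by
  set g' : ℕ → ℝ → ℝ := fun j y => j * y ^ (j - 1) / j.factorial * c j with hg'
  have hsucc (j : ℕ) (y : ℝ) : g' (j + 1) y = y ^ j / j.factorial * c (j + 1) := by
    simp only [hg', Nat.factorial_succ, Nat.add_sub_cancel]
    push_cast
    field_simp
  set r : ℝ := |z| + 1 with hr
  have hr0 : 0 < r := by positivity
  have hu : Summable fun j => |g' j r| := by
    rw [← summable_nat_add_iff 1]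
    refine (hc r hr0.le).congr fun j => ?_
    rw [hsucc, abs_mul, abs_of_nonneg (by positivity : 0 ≤ r ^ j / (j.factorial : ℝ))]
  have hz : z ∈ Metric.ball (0 : ℝ) r := by simp [hr]
  have hbd : ∀ (j : ℕ) (y : ℝ), y ∈ Metric.ball (0 : ℝ) r → ‖g' j y‖ ≤ |g' j r| := by
    intro j y hy
    have hy' : |y| ≤ |r| := by
      rw [abs_of_pos hr0]
      simpa using (mem_ball_zero_iff.1 hy).le
    simp only [hg', Real.norm_eq_abs, abs_mul, abs_div, abs_pow]
    gcongr
  have key := hasDerivAt_tsum_of_isPreconnected (g := fun j y => y ^ j / j.factorial * c j)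
    (g' := g') hu Metric.isOpen_ball (convex_ball (0 : ℝ) r).isPreconnected
    (fun j y _ => ((hasDerivAt_pow j y).div_const _).mul_const _) hbd
    (Metric.mem_ball_self hr0)
    (summable_of_ne_finset_zero (s := {0}) fun j hj => by
      simp [zero_pow (by simpa using hj : j ≠ 0)]) hz
  have hsum : Summable fun j => g' j z := hu.of_norm_bounded fun j => hbd j z hz
  rw [hsum.tsum_eq_zero_add] at key
  simpa only [hsucc, show g' 0 z = 0 by simp [hg'], zero_add] using key

lemma R_eq (μ ν a t : ℝ) : R μ ν a t = t ^ (μ - 1) *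
    ∑' j : ℕ, (-(a * t ^ (-ν))) ^ j / j.factorial * (Real.Gamma (-ν * j + μ))⁻¹ := by
  simp only [R, div_eq_mul_inv, mul_inv, mul_assoc]

theorem R_hasDerivAt_a (μ ν t : ℝ) (hν : 0 < ν) (hν' : ν ≤ 1 / 2) (hμ : ν ≤ μ)
    (ht : 0 < t) (a : ℝ) (ha : 0 < a) :
    HasDerivAt (fun a => R μ ν a t) (-(R (μ - ν) ν a t)) a := by
  have hshift (j : ℕ) : -ν * ((j + 1 : ℕ) : ℝ) + μ = -ν * j + (μ - ν) := by
    push_cast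
    ring
  have hseries := hasDerivAt_tsum_pow_div_factorial_mul
    (c := fun j => (Real.Gamma (-ν * j + μ))⁻¹)
    (fun r hr => by
      simpa only [hshift] using
        summable_pow_div_factorial_mul_abs_inv_Gamma hν hν' (sub_nonneg.2 hμ) hr)
    (-(a * t ^ (-ν)))
  simp only [hshift] at hseries
  have hinner : HasDerivAt (fun a : ℝ => -(a * t ^ (-ν))) (-(1 * t ^ (-ν))) a :=
    ((hasDerivAt_id a).mul_const _).neg
  have h := (hseries.comp a hinner).const_mul (t ^ (μ - 1))
  simp only [R_eq]
  refine h.congr_deriv ?_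
  rw [show μ - ν - 1 = (μ - 1) + -ν by ring, Real.rpow_add ht]
  ring
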